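/- arXiv:0804.2707 — 2 statements merged into one kernel-verified Lean document; each statement's English description precedes it below -/
import Mathlib

section
/- Let p₁, p₂, p₃, p₄ ∈ L⁴ be pairwise non-proportional and suppose p₃ is a nonzero scalar multiple of Γ^{a/b}_{p₂,p₄}(p₁) for some a, b ∈ ℝ∖{0} (so the four points are concircular with cross ratio [p₁;p₂;p₃;p₄] = a/b). Then for every λ ∈ ℝ with a·λ ≠ 1 and b·λ ≠ 1 one has the identities of linear maps on ℝ^5: Γ^{1−aλ}_{p₁,p₂} ∘ Γ^{1−bλ}_{p₂,p₃} = Γ^{(1−bλ)/(1−aλ)}_{p₂,p₄} = Γ^{(1−aλ)/(1−bλ)}_{p₄,p₂} = Γ^{1−bλ}_{p₁,p₄} ∘ Γ^{1−aλ}_{p₄,p₃}. -/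
noncomputable section

/-- The Minkowski bilinear form of signature (4,1) on `ℝ^5`. -/
def mink (x y : Fin 5 → ℝ) : ℝ :=
  -(x 0 * y 0) + x 1 * y 1 + x 2 * y 2 + x 3 * y 3 + x 4 * y 4

/-- The light cone `L⁴ ⊂ ℝ^{4,1}`. -/
def LightCone (x : Fin 5 → ℝ) : Prop :=
  x ≠ 0 ∧ mink x x = 0

/-- The map `Γ^q_{p,p'}` of the paper. -/
def Gamma (p p' : Fin 5 → ℝ) (q : ℝ) (X : Fin 5 → ℝ) : Fin 5 → ℝ :=
  X + (1 / mink p p') •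
    (((q - 1) * mink X p') • p + ((1 / q - 1) * mink X p) • p')

/-- Two vectors are proportional if one is a scalar multiple of the other. -/
def Proportional (x y : Fin 5 → ℝ) : Prop :=
  (∃ t : ℝ, y = t • x) ∨ (∃ t : ℝ, x = t • y)

/-- Membership in the rectangular grid `M`. -/
def InGrid (m₁ m₂ n₁ n₂ : ℤ) (i : ℤ × ℤ) : Prop :=
  m₁ ≤ i.1 ∧ i.1 ≤ m₂ ∧ n₁ ≤ i.2 ∧ i.2 ≤ n₂

/-- `(i,j)` is an edge of the grid (in either orientation). -/
def IsEdge (m₁ m₂ n₁ n₂ : ℤ) (i j : ℤ × ℤ) : Prop :=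
  InGrid m₁ m₂ n₁ n₂ i ∧ InGrid m₁ m₂ n₁ n₂ j ∧
    ((j.1 = i.1 + 1 ∧ j.2 = i.2) ∨ (i.1 = j.1 + 1 ∧ i.2 = j.2) ∨
     (j.1 = i.1 ∧ j.2 = i.2 + 1) ∨ (i.1 = j.1 ∧ i.2 = j.2 + 1))

/-- `(i,j,k,l)` is an elementary quadrilateral (face) of the grid. -/
def IsFace (m₁ m₂ n₁ n₂ : ℤ) (i j k l : ℤ × ℤ) : Prop :=
  InGrid m₁ m₂ n₁ n₂ i ∧ InGrid m₁ m₂ n₁ n₂ k ∧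
    j = (i.1 + 1, i.2) ∧ k = (i.1 + 1, i.2 + 1) ∧ l = (i.1, i.2 + 1)

/-- Four vectors are pairwise non-proportional. -/
def FaceRegular (v w x y : Fin 5 → ℝ) : Prop :=
  ¬ Proportional v w ∧ ¬ Proportional v x ∧ ¬ Proportional v y ∧
  ¬ Proportional w x ∧ ¬ Proportional w y ∧ ¬ Proportional x y

/-- A discrete isothermic net (with values in the light cone) with cross ratio
factorizing function `a`. -/
structure IsIsothermic (m₁ m₂ n₁ n₂ : ℤ) (F : ℤ × ℤ → Fin 5 → ℝ)
    (a : ℤ × ℤ → ℤ × ℤ → ℝ) : Prop where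
  lightcone : ∀ i, InGrid m₁ m₂ n₁ n₂ i → LightCone (F i)
  regular : ∀ i j k l, IsFace m₁ m₂ n₁ n₂ i j k l →
    FaceRegular (F i) (F j) (F k) (F l)
  symm : ∀ i j, IsEdge m₁ m₂ n₁ n₂ i j → a i j = a j i
  nonzero : ∀ i j, IsEdge m₁ m₂ n₁ n₂ i j → a i j ≠ 0
  opposite : ∀ i j k l, IsFace m₁ m₂ n₁ n₂ i j k l →
    a i j = a l k ∧ a i l = a j k
  cross : ∀ i j k l, IsFace m₁ m₂ n₁ n₂ i j k l →
    ∃ t : ℝ, t ≠ 0 ∧ F k = t • Gamma (F j) (F l) (a i j / a i l) (F i)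

/-- Evaluation of the polynomial with vector coefficients `P i 0, …, P i N`
at the spectral parameter `lam`. -/
def pcqEval (N : ℕ) (P : ℤ × ℤ → ℕ → Fin 5 → ℝ) (i : ℤ × ℤ) (lam : ℝ) :
    Fin 5 → ℝ :=
  ∑ k ∈ Finset.range (N + 1), lam ^ k • P i k

/-- `P` is a polynomial conserved quantity of degree at most `N` of the net `F`
with cross ratio factorizing function `a`. -/
def IsPCQ (m₁ m₂ n₁ n₂ : ℤ) (F : ℤ × ℤ → Fin 5 → ℝ) (a : ℤ × ℤ → ℤ × ℤ → ℝ)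
    (N : ℕ) (P : ℤ × ℤ → ℕ → Fin 5 → ℝ) : Prop :=
  ∀ i j, IsEdge m₁ m₂ n₁ n₂ i j → ∀ lam : ℝ, lam * a i j ≠ 1 →
    pcqEval N P i lam = Gamma (F i) (F j) (1 - lam * a i j) (pcqEval N P j lam)

/-- A polynomial conserved quantity is normalized (of degree `N`) if its top
coefficient has Minkowski square norm one at every vertex. -/
def Normalized (m₁ m₂ n₁ n₂ : ℤ) (N : ℕ) (P : ℤ × ℤ → ℕ → Fin 5 → ℝ) : Prop :=
  ∀ i, InGrid m₁ m₂ n₁ n₂ i → mink (P i N) (P i N) = 1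

/-- A Darboux transform of `F` with parameter `μ`. -/
def IsDarboux (m₁ m₂ n₁ n₂ : ℤ) (F : ℤ × ℤ → Fin 5 → ℝ) (a : ℤ × ℤ → ℤ × ℤ → ℝ)
    (μ : ℝ) (Fh : ℤ × ℤ → Fin 5 → ℝ) : Prop :=
  (∀ i, InGrid m₁ m₂ n₁ n₂ i → LightCone (Fh i)) ∧
  (∀ i, InGrid m₁ m₂ n₁ n₂ i → ¬ Proportional (F i) (Fh i)) ∧
  (∀ i j, IsEdge m₁ m₂ n₁ n₂ i j → Fh i = Gamma (F i) (F j) (1 - μ * a i j) (Fh j))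

/-- A Calapso transformation of `F` at parameter `μ`: a vertexwise family of
linear isometries of `ℝ^{4,1}` gauging the isothermic connection at `μ` to the
trivial connection. -/
def IsCalapso (m₁ m₂ n₁ n₂ : ℤ) (F : ℤ × ℤ → Fin 5 → ℝ) (a : ℤ × ℤ → ℤ × ℤ → ℝ)
    (μ : ℝ) (T : ℤ × ℤ → (Fin 5 → ℝ) → (Fin 5 → ℝ)) : Prop :=
  (∀ i, InGrid m₁ m₂ n₁ n₂ i → IsLinearMap ℝ (T i)) ∧
  (∀ i, InGrid m₁ m₂ n₁ n₂ i → ∀ x y, mink (T i x) (T i y) = mink x y) ∧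
  (∀ i j, IsEdge m₁ m₂ n₁ n₂ i j → ∀ x,
    T j x = T i (Gamma (F i) (F j) (1 - μ * a i j) x))

theorem mink_smul_add (x y : Fin 5 → ℝ) (c : ℝ) : mink (c • x) y = c * mink x y := by
  simp [mink]; ring

theorem mink_add_l (x y z : Fin 5 → ℝ) : mink (x + y) z = mink x z + mink y z := by
  simp [mink]; ring

theorem mink_comm5 (x y : Fin 5 → ℝ) : mink x y = mink y x := by
  simp [mink]; ring

theorem mink_ne (x y : Fin 5 → ℝ) (hx : LightCone x) (hy : LightCone y)
    (h : ¬ Proportional x y) : mink x y ≠ 0 := by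
  intro h0
  obtain ⟨hx0, hxx⟩ := hx
  obtain ⟨_, hyy⟩ := hy
  simp only [mink] at h0 hxx hyy
  have hx00 : x 0 ≠ 0 := by
    intro hz
    apply hx0
    rw [hz] at hxx
    funext i
    fin_cases i <;> simp
    · exact hz
    all_goals
      rw [← sq_eq_zero_iff]
      nlinarith [sq_nonneg (x 1), sq_nonneg (x 2), sq_nonneg (x 3), sq_nonneg (x 4)]
  apply h
  left
  refine ⟨y 0 / x 0, ?_⟩
  have key : (x 0 * y 1 - y 0 * x 1)^2 + (x 0 * y 2 - y 0 * x 2)^2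
      + (x 0 * y 3 - y 0 * x 3)^2 + (x 0 * y 4 - y 0 * x 4)^2 = 0 := by
    linear_combination (x 0)^2 * hyy + (y 0)^2 * hxx - 2 * x 0 * y 0 * h0
  have aux : ∀ i, x 0 * y i - y 0 * x i = 0 → y i = (y 0 / x 0) * x i := by
    intro i hi
    field_simp
    linarith
  funext i
  simp only [Pi.smul_apply, smul_eq_mul]
  apply aux
  rw [← sq_eq_zero_iff]
  fin_cases i <;> simp
  · ring
  all_goals
    rw [← sq_eq_zero_iff]
    nlinarith [sq_nonneg (x 0 * y 1 - y 0 * x 1), sq_nonneg (x 0 * y 2 - y 0 * x 2),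
      sq_nonneg (x 0 * y 3 - y 0 * x 3), sq_nonneg (x 0 * y 4 - y 0 * x 4)]

theorem gamma_swap (p p' : Fin 5 → ℝ) (u v : ℝ) (X : Fin 5 → ℝ) :
    Gamma p p' (u / v) X = Gamma p' p (v / u) X := by
  simp only [Gamma, one_div_div, mink_comm5 p' p]
  rw [add_comm (_ • p)]

theorem gamma_main (p₁ p₂ p₃ p₄ : Fin 5 → ℝ)
    (h1 : LightCone p₁) (h2 : LightCone p₂) (h4 : LightCone p₄)
    (h12 : ¬ Proportional p₁ p₂)
    (h24 : ¬ Proportional p₂ p₄)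
    (A B : ℝ) (hA : A ≠ 0) (hB : B ≠ 0)
    (t : ℝ) (ht : t ≠ 0) (hconc : p₃ = t • Gamma p₂ p₄ (A / B) p₁)
    (lam : ℝ) (hAl : A * lam ≠ 1) (hBl : B * lam ≠ 1) (X : Fin 5 → ℝ) :
      Gamma p₁ p₂ (1 - A * lam) (Gamma p₂ p₃ (1 - B * lam) X)
        = Gamma p₂ p₄ ((1 - B * lam) / (1 - A * lam)) X := by
  have c12 := mink_ne _ _ h1 h2 h12
  have c24 := mink_ne _ _ h2 h4 h24
  have hu : 1 - A * lam ≠ 0 := fun h => hAl (by linarith)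
  have hv : 1 - B * lam ≠ 0 := fun h => hBl (by linarith)
  have h11 := h1.2
  have h22 := h2.2
  have h44 := h4.2
  have e3 : ∀ Y, mink p₃ Y = t * (mink p₁ Y + (1 / mink p₂ p₄) * ((A / B - 1) * mink p₁ p₄ * mink p₂ Y
      + (B / A - 1) * mink p₁ p₂ * mink p₄ Y)) := by
    intro Y
    rw [hconc]
    simp only [Gamma, mink_smul_add, mink_add_l, one_div_div]
  have c23 : mink p₂ p₃ = t * (B / A) * mink p₁ p₂ := by
    rw [mink_comm5, e3, h22, mink_comm5 p₄ p₂]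
    field_simp
    ring
  have c13 : mink p₃ p₁ = t * ((A / B - 1) + (B / A - 1)) * mink p₁ p₂ * mink p₁ p₄ / mink p₂ p₄ := by
    rw [e3, h11, mink_comm5 p₂ p₁, mink_comm5 p₄ p₁]
    field_simp
    ring
  have cX3 : mink X p₃ = t * (mink X p₁ + (1 / mink p₂ p₄) * ((A / B - 1) * mink p₁ p₄ * mink X p₂
      + (B / A - 1) * mink p₁ p₂ * mink X p₄)) := by
    rw [mink_comm5, e3, mink_comm5 p₁ X, mink_comm5 p₂ X, mink_comm5 p₄ X]
  have c32 : mink p₃ p₂ = t * (B / A) * mink p₁ p₂ := by rw [mink_comm5, c23]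
  funext i
  have p3i : p₃ i = t * (p₁ i + (1 / mink p₂ p₄) * ((A / B - 1) * mink p₁ p₄ * p₂ i
      + (B / A - 1) * mink p₁ p₂ * p₄ i)) := by
    rw [hconc]
    simp only [Gamma, one_div_div, Pi.add_apply, Pi.smul_apply, smul_eq_mul]
  simp only [Gamma, Pi.add_apply, Pi.smul_apply, smul_eq_mul, mink_smul_add, mink_add_l, c13, c32,
    c23, cX3, h22, p3i, mink_comm5 p₂ p₁]
  clear p3i c32 cX3 c13 c23 e3 hconc
  generalize mink p₁ p₂ = m12 at *
  generalize mink p₂ p₄ = m24 at *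
  generalize mink p₁ p₄ = m14 at *
  generalize mink X p₁ = x1 at *
  generalize mink X p₂ = x2 at *
  generalize mink X p₄ = x4 at *
  field_simp
  ring

/-- the cross-ratio identity for the maps `Γ` associated with four
concircular points with cross ratio `A/B`. -/
theorem statement2 (p₁ p₂ p₃ p₄ : Fin 5 → ℝ)
    (h1 : LightCone p₁) (h2 : LightCone p₂) (h3 : LightCone p₃)
    (h4 : LightCone p₄)
    (h12 : ¬ Proportional p₁ p₂) (h13 : ¬ Proportional p₁ p₃)
    (h14 : ¬ Proportional p₁ p₄) (h23 : ¬ Proportional p₂ p₃)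
    (h24 : ¬ Proportional p₂ p₄) (h34 : ¬ Proportional p₃ p₄)
    (A B : ℝ) (hA : A ≠ 0) (hB : B ≠ 0)
    (t : ℝ) (ht : t ≠ 0) (hconc : p₃ = t • Gamma p₂ p₄ (A / B) p₁)
    (lam : ℝ) (hAl : A * lam ≠ 1) (hBl : B * lam ≠ 1) :
    (∀ X : Fin 5 → ℝ,
      Gamma p₁ p₂ (1 - A * lam) (Gamma p₂ p₃ (1 - B * lam) X)
        = Gamma p₂ p₄ ((1 - B * lam) / (1 - A * lam)) X) ∧
    (∀ X : Fin 5 → ℝ,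
      Gamma p₂ p₄ ((1 - B * lam) / (1 - A * lam)) X
        = Gamma p₄ p₂ ((1 - A * lam) / (1 - B * lam)) X) ∧
    (∀ X : Fin 5 → ℝ,
      Gamma p₄ p₂ ((1 - A * lam) / (1 - B * lam)) X
        = Gamma p₁ p₄ (1 - B * lam) (Gamma p₄ p₃ (1 - A * lam) X)) := by
  refine ⟨fun X => gamma_main p₁ p₂ p₃ p₄ h1 h2 h4 h12 h24 A B hA hB t ht hconc lam hAl hBl X,
    fun X => gamma_swap _ _ _ _ X, fun X => ?_⟩
  have h42 : ¬ Proportional p₄ p₂ := fun h => h24 (Or.symm h)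
  rw [gamma_swap] at hconc
  exact (gamma_main p₁ p₄ p₃ p₂ h1 h4 h2 h14 h42 B A hB hA t ht hconc lam hBl hAl X).symm
end
end

section
/- Let F be a discrete isothermic net with cross ratio factorizing function a which admits no nonzero polynomial conserved quantity of degree ≤ N−1. If P and P̃ are polynomial conserved quantities of F of degree ≤ N such that either their top coefficient functions agree (P_i^{(N)} = P̃_i^{(N)} at every vertex i) or their constant coefficients agree (P_i^{(0)} = P̃_i^{(0)} at every vertex i), then P = P̃. In words: a nonzero polynomial conserved quantity of lowest possible degree N is uniquely determined by its top coefficient Z = P^{(N)}, and also by its bottom coefficient Q = P^{(0)}. -/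
noncomputable section

theorem mink_sub_left (x y z : Fin 5 → ℝ) : mink (x - y) z = mink x z - mink y z := by
  simp only [mink, Pi.sub_apply]; ring

theorem mink_smul_left (c : ℝ) (x z : Fin 5 → ℝ) : mink (c • x) z = c * mink x z := by
  simp only [mink, Pi.smul_apply, smul_eq_mul]; ring

theorem Gamma_sub (p p' : Fin 5 → ℝ) (q : ℝ) (x y : Fin 5 → ℝ) :
    Gamma p p' q (x - y) = Gamma p p' q x - Gamma p p' q y := by
  funext t
  simp only [Gamma, mink_sub_left, Pi.sub_apply, Pi.add_apply, Pi.smul_apply, smul_eq_mul]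
  ring

theorem Gamma_smul (p p' : Fin 5 → ℝ) (q c : ℝ) (x : Fin 5 → ℝ) :
    Gamma p p' q (c • x) = c • Gamma p p' q x := by
  funext t
  simp only [Gamma, mink_smul_left, Pi.add_apply, Pi.smul_apply, smul_eq_mul]
  ring

theorem pcqEval_continuous (K : ℕ) (E : ℤ × ℤ → ℕ → Fin 5 → ℝ) (i : ℤ × ℤ) :
    Continuous (pcqEval K E i) := by
  unfold pcqEval
  fun_prop

theorem Gamma_continuousAt (p p' : Fin 5 → ℝ) (a : ℝ) (X : ℝ → Fin 5 → ℝ) (hX : Continuous X) :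
    ContinuousAt (fun lam : ℝ => Gamma p p' (1 - lam * a) (X lam)) 0 := by
  unfold Gamma mink
  have h : (1 - (0:ℝ) * a) ≠ 0 := by simp
  fun_prop (disch := exact h)

theorem pcq_sub {m₁ m₂ n₁ n₂ : ℤ} {F : ℤ × ℤ → Fin 5 → ℝ}
    {a : ℤ × ℤ → ℤ × ℤ → ℝ} {N : ℕ} {P Pt : ℤ × ℤ → ℕ → Fin 5 → ℝ}
    (hP : IsPCQ m₁ m₂ n₁ n₂ F a N P) (hPt : IsPCQ m₁ m₂ n₁ n₂ F a N Pt)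
    {i j : ℤ × ℤ} (hij : IsEdge m₁ m₂ n₁ n₂ i j) (lam : ℝ) (hl : lam * a i j ≠ 1) :
    pcqEval N P i lam - pcqEval N Pt i lam =
      Gamma (F i) (F j) (1 - lam * a i j) (pcqEval N P j lam - pcqEval N Pt j lam) := by
  rw [Gamma_sub, ← hP i j hij lam hl, ← hPt i j hij lam hl]

/-- a polynomial conserved quantity of lowest possible degree is
uniquely determined by its top coefficient, and also by its bottom
coefficient. -/
theorem statement4 (m₁ m₂ n₁ n₂ : ℤ) (F : ℤ × ℤ → Fin 5 → ℝ)
    (a : ℤ × ℤ → ℤ × ℤ → ℝ) (N : ℕ)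
    (hiso : IsIsothermic m₁ m₂ n₁ n₂ F a)
    (hmin : ∀ K : ℕ, K < N → ∀ P' : ℤ × ℤ → ℕ → Fin 5 → ℝ,
      IsPCQ m₁ m₂ n₁ n₂ F a K P' →
      ∀ i, InGrid m₁ m₂ n₁ n₂ i → ∀ lam : ℝ, pcqEval K P' i lam = 0)
    (P Pt : ℤ × ℤ → ℕ → Fin 5 → ℝ)
    (hP : IsPCQ m₁ m₂ n₁ n₂ F a N P) (hPt : IsPCQ m₁ m₂ n₁ n₂ F a N Pt)
    (hcoeff : (∀ i, InGrid m₁ m₂ n₁ n₂ i → P i N = Pt i N) ∨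
              (∀ i, InGrid m₁ m₂ n₁ n₂ i → P i 0 = Pt i 0)) :
    ∀ i, InGrid m₁ m₂ n₁ n₂ i → ∀ lam : ℝ,
      pcqEval N P i lam = pcqEval N Pt i lam := by
  intro i hi lam
  cases N with
  | zero =>
    have h : P i 0 = Pt i 0 := by
      rcases hcoeff with h | h <;> exact h i hi
    simp [pcqEval, h]
  | succ K =>
    rcases hcoeff with h | h
    · have key : ∀ j, InGrid m₁ m₂ n₁ n₂ j → ∀ l : ℝ,
          pcqEval (K + 1) P j l - pcqEval (K + 1) Pt j l =
            pcqEval K (fun j k => P j k - Pt j k) j l := by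
        intro j hj l
        unfold pcqEval
        rw [Finset.sum_range_succ _ (K + 1), Finset.sum_range_succ _ (K + 1), h j hj]
        simp only [smul_sub, Finset.sum_sub_distrib]
        abel
      rw [← sub_eq_zero, key i hi]
      refine hmin K (Nat.lt_succ_self K) _ ?_ i hi lam
      intro i j hij l hl
      rw [← key i hij.1, ← key j hij.2.1]
      exact pcq_sub hP hPt hij l hl
    · have key : ∀ j, InGrid m₁ m₂ n₁ n₂ j → ∀ l : ℝ,
          pcqEval (K + 1) P j l - pcqEval (K + 1) Pt j l =
            l • pcqEval K (fun j k => P j (k + 1) - Pt j (k + 1)) j l := by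
        intro j hj l
        unfold pcqEval
        rw [Finset.sum_range_succ' _ (K + 1), Finset.sum_range_succ' _ (K + 1), h j hj]
        simp only [smul_sub, Finset.sum_sub_distrib, Finset.smul_sum, smul_smul, pow_succ']
        abel
      rw [← sub_eq_zero, key i hi]
      rw [hmin K (Nat.lt_succ_self K) _ ?_ i hi lam, smul_zero]
      intro i j hij l hl
      have main : ∀ l : ℝ, l ≠ 0 → l * a i j ≠ 1 →
          pcqEval K (fun j k => P j (k + 1) - Pt j (k + 1)) i l =
          Gamma (F i) (F j) (1 - l * a i j)
            (pcqEval K (fun j k => P j (k + 1) - Pt j (k + 1)) j l) := by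
        intro l h0 hl
        have e := pcq_sub hP hPt hij l hl
        rw [key i hij.1, key j hij.2.1, Gamma_smul] at e
        exact smul_right_injective _ h0 e
      by_cases h0 : l = 0
      · subst h0
        have c1 := (pcqEval_continuous K (fun j k => P j (k + 1) - Pt j (k + 1)) i).continuousAt
          (x := (0 : ℝ))
        have c2 := Gamma_continuousAt (F i) (F j) (a i j) _
          (pcqEval_continuous K (fun j k => P j (k + 1) - Pt j (k + 1)) j)
        have t1 := c1.tendsto.mono_left (nhdsWithin_le_nhds (s := {(0 : ℝ)}ᶜ))
        have t2 := c2.tendsto.mono_left (nhdsWithin_le_nhds (s := {(0 : ℝ)}ᶜ))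
        refine tendsto_nhds_unique_of_eventuallyEq t1 t2 ?_
        have c3 : ContinuousAt (fun l : ℝ => l * a i j) 0 := by fun_prop
        have ev := (c3.eventually_ne (y := (1 : ℝ)) (by simp)).filter_mono
          (nhdsWithin_le_nhds (s := {(0 : ℝ)}ᶜ))
        filter_upwards [ev, self_mem_nhdsWithin] with l h1 h2
        exact main l h2 h1
      · exact main l h0 hl
end
end
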